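/- Let z be an integer, φ = [[0,1],[1,z]] and τ = [[1,0],[0,-1]]. Then for every integer s ≥ 1, (φ⁻¹·τ·φ·τ)^{s−1} · φ⁻¹·τ·φ = (−1)^s · [[1, 2s·z],[0, −1]]. -/

import Mathlib

theorem inv_companion (z : ℤ) : (!![0, 1; 1, z])⁻¹ = !![-z, 1; 1, 0] :=
  Matrix.inv_eq_right_inv <| by simp [Matrix.one_fin_two]

theorem neg_one_shear_pow_mul (z : ℤ) (n : ℕ) :
    !![-1, 2 * z; 0, -1] ^ n * !![-1, -(2 * z); 0, 1]
      = ((-1 : ℤ) ^ (n + 1)) • !![1, 2 * ((n + 1 : ℕ) : ℤ) * z; 0, -1] := by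
  induction n with
  | zero => simp
  | succ n ih =>
    rw [pow_succ', mul_assoc, ih]
    ext i j
    fin_cases i <;> fin_cases j <;> simp [pow_succ]
    ring

/-- Case (A) of Section 4 (case 2.II): for `φ = [[0,1],[1,z]]` and `τ = [[1,0],[0,-1]]`,
`(φ⁻¹τφτ)^(s−1) · φ⁻¹τφ = (−1)^s · [[1, 2sz],[0, −1]]` for all `s ≥ 1`. -/
theorem semi_bundle_word_even_case (z : ℤ) (s : ℕ) (hs : 1 ≤ s) :
    ((!![0, 1; 1, z])⁻¹ * !![1, 0; 0, -1] * !![0, 1; 1, z] * !![1, 0; 0, -1]) ^ (s - 1)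
        * ((!![0, 1; 1, z])⁻¹ * !![1, 0; 0, -1] * !![0, 1; 1, z])
      = ((-1 : ℤ) ^ s) • !![1, 2 * (s : ℤ) * z; 0, -1] := by
  obtain ⟨n, rfl⟩ := Nat.exists_eq_add_of_le' hs
  have word : (!![0, 1; 1, z])⁻¹ * !![1, 0; 0, -1] * !![0, 1; 1, z] = !![-1, -(2 * z); 0, 1] := by
    rw [inv_companion]
    simp
    ring
  have base : !![-1, -(2 * z); 0, 1] * !![1, 0; 0, -1] = !![-1, 2 * z; 0, -1] := by
    simp
  rw [word, base, Nat.add_sub_cancel]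
  exact neg_one_shear_pow_mul z n
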